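/- Let {X_n, n≥1} be a φ-mixing sequence of random variables with Σ_{n=1}^∞ φ^{1/2}(n) < ∞. Fix p ∈ (0,1) and assume the common marginal distribution function F possesses a positive continuous density f in a neighborhood N_p of ξ_p such that 0 < d = sup{f(x) : x ∈ N_p} < ∞. For any θ > 0, put τ_n = ((16 C_3 + θ)^{1/2} (log n)^{3/2}) / (n^{1/2} (log log n)^{1/2}) and E_n = [ξ_p − τ_n, ξ_p + τ_n], where C_3 = 4[1 + 4 Σ_{n=1}^∞ φ^{1/2}(n)]. Then with probability 1, sup_{x ∈ E_n} |F_n(x) − F(x)| ≤ (1 + d) ((16 C_3 + θ) log n / (4n))^{1/2} for all n sufficiently large. -/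

import Mathlib

open MeasureTheory Filter Set

/-- The σ-algebra generated by the random variables `X i` for `i ∈ S`. -/
noncomputable def sigmaGen {Ω : Type*} (X : ℕ → Ω → ℝ) (S : Set ℕ) : MeasurableSpace Ω :=
  ⨆ i ∈ S, MeasurableSpace.comap (X i) inferInstance

/-- The φ-mixing coefficients of the sequence `X` with respect to the measure `μ`:
`φ(n) = sup_{k ≥ 1} sup { |P(B|A) - P(B)| : A ∈ σ(X_i, 1 ≤ i ≤ k), P(A) > 0,
B ∈ σ(X_i, i ≥ k + n) }`. -/
noncomputable def phiCoef {Ω : Type*} [MeasurableSpace Ω] (X : ℕ → Ω → ℝ)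
    (μ : Measure Ω) (n : ℕ) : ℝ :=
  sSup {r : ℝ | ∃ k : ℕ, 1 ≤ k ∧ ∃ A B : Set Ω,
    MeasurableSet[sigmaGen X {i | 1 ≤ i ∧ i ≤ k}] A ∧
    MeasurableSet[sigmaGen X {i | k + n ≤ i}] B ∧
    0 < μ A ∧
    r = |(μ (A ∩ B)).toReal / (μ A).toReal - (μ B).toReal|}

/-- The empirical distribution function `F_n(x) = n⁻¹ ∑_{i=1}^n I(X_i ≤ x)`. -/
noncomputable def empDF {Ω : Type*} (X : ℕ → Ω → ℝ) (n : ℕ) (ω : Ω) (x : ℝ) : ℝ :=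
  (n : ℝ)⁻¹ * ∑ i ∈ Finset.Icc 1 n, (if X i ω ≤ x then (1 : ℝ) else 0)

/-- The `p`-th quantile `F⁻¹(p) = inf {x : F(x) ≥ p}` of a distribution function `F`. -/
noncomputable def quantile (F : ℝ → ℝ) (p : ℝ) : ℝ :=
  sInf {x : ℝ | p ≤ F x}

/-- The sample `p`-th quantile `ξ_{p,n} = F_n⁻¹(p) = inf {x : F_n(x) ≥ p}`. -/
noncomputable def sampleQuantile {Ω : Type*} (X : ℕ → Ω → ℝ) (n : ℕ) (ω : Ω) (p : ℝ) : ℝ :=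
  sInf {x : ℝ | p ≤ empDF X n ω x}

/-- If the integral of `ξ` over every `m`-measurable set `A` is at most `c * μ A` in absolute
value, then the same holds for integrals against `m`-measurable weights. -/
lemma abs_integral_mul_le_of_forall_setIntegral {Ω : Type*} {m m0 : MeasurableSpace Ω}
    {μ : Measure Ω} [IsFiniteMeasure μ] (hm : m ≤ m0) {ξ Z : Ω → ℝ} (hξ : Integrable ξ μ)
    (hZ : StronglyMeasurable[m] Z) (hZi : Integrable Z μ)
    (hZξ : Integrable (fun ω => Z ω * ξ ω) μ) {c : ℝ}
    (h : ∀ A, MeasurableSet[m] A → |∫ ω in A, ξ ω ∂μ| ≤ c * μ.real A) :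
    |∫ ω, Z ω * ξ ω ∂μ| ≤ c * ∫ ω, |Z ω| ∂μ := by
  have hcond : ∀ A, MeasurableSet[m] A →
      ∫ ω in A, (μ[ξ|m]) ω ∂μ.trim hm = ∫ ω in A, ξ ω ∂μ := fun A hA => by
    rw [← setIntegral_condExp hm hξ hA, ← setIntegral_trim hm stronglyMeasurable_condExp hA]
  have hint : Integrable (μ[ξ|m]) (μ.trim hm) :=
    integrable_condExp.trim hm stronglyMeasurable_condExp
  have hreal : ∀ A, MeasurableSet[m] A → (μ.trim hm).real A = μ.real A := fun A hA => by
    simp [Measure.real, trim_measurableSet_eq hm hA]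
  have hup : ∀ᵐ ω ∂μ, (μ[ξ|m]) ω ≤ c := by
    refine ae_le_of_ae_le_trim (hm := hm) (f₂ := fun _ => c) ?_
    refine ae_le_of_forall_setIntegral_le hint (integrable_const c) fun A hA _ => ?_
    rw [hcond A hA, setIntegral_const, hreal A hA, smul_eq_mul, mul_comm]
    exact (abs_le.1 (h A hA)).2
  have hlo : ∀ᵐ ω ∂μ, -c ≤ (μ[ξ|m]) ω := by
    refine ae_le_of_ae_le_trim (hm := hm) (f₁ := fun _ => -c) ?_
    refine ae_le_of_forall_setIntegral_le (integrable_const (-c)) hint fun A hA _ => ?_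
    rw [hcond A hA, setIntegral_const, hreal A hA, smul_eq_mul, mul_neg, mul_comm]
    exact (abs_le.1 (h A hA)).1
  have hpull : μ[fun ω => Z ω * ξ ω|m] =ᵐ[μ] fun ω => Z ω * (μ[ξ|m]) ω :=
    condExp_mul_of_stronglyMeasurable_left hZ hZξ hξ
  rw [← integral_condExp hm, ← integral_const_mul]
  refine (abs_integral_le_integral_abs).trans ?_
  refine integral_mono_ae integrable_condExp.abs (hZi.abs.const_mul c) ?_
  filter_upwards [hpull, hup, hlo] with ω h1 h2 h3
  rw [h1, abs_mul, mul_comm]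
  exact mul_le_mul_of_nonneg_right (abs_le.2 ⟨h3, h2⟩) (abs_nonneg _)

/-- Moment generating function bound for the partial sums of a bounded centred sequence whose
conditional means given the past decay at a summable rate. -/
lemma integral_exp_sum_le {Ω : Type*} [m0 : MeasurableSpace Ω] {μ : Measure Ω}
    [IsProbabilityMeasure μ] {m : ℕ → MeasurableSpace Ω} (hm : ∀ j, m j ≤ m0)
    (hmono : Monotone m) {Y : ℕ → Ω → ℝ} (hY : ∀ j, Measurable[m (j + 1)] (Y j))
    (hY1 : ∀ j ω, |Y j ω| ≤ 1) (hY0 : ∀ j, ∫ ω, Y j ω ∂μ = 0) {φ : ℕ → ℝ}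
    (hφ0 : ∀ n, 0 ≤ φ n) (hφ : Summable fun n => φ (n + 1))
    (hmix : ∀ j k, j < k → ∀ A, MeasurableSet[m (j + 1)] A →
      |∫ ω in A, Y k ω ∂μ| ≤ φ (k - j) * μ.real A)
    {l : ℝ} (hl : |l| ≤ 1) (n : ℕ) :
    ∫ ω, Real.exp (l * ∑ i ∈ Finset.range n, Y i ω) ∂μ ≤
      (1 + l ^ 2 * (1 + 2 * ∑' n, φ (n + 1))) ^ n := by
  set K : ℝ := 1 + 2 * ∑' n, φ (n + 1) with hK
  have hΦ0 : 0 ≤ ∑' n, φ (n + 1) := tsum_nonneg fun n => hφ0 _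
  have hc0 : 0 ≤ l ^ 2 * K := by positivity
  set E : ℕ → Ω → ℝ := fun k ω => Real.exp (l * ∑ i ∈ Finset.range k, Y i ω) with hE
  have hEm : ∀ k, Measurable[m k] (E k) := fun k => by
    have hs : Measurable[m k] fun ω => ∑ i ∈ Finset.range k, Y i ω :=
      Finset.measurable_fun_sum _ fun i hi =>
        (hY i).mono (hmono (Finset.mem_range.1 hi)) le_rfl
    exact Real.measurable_exp.comp (hs.const_mul l)
  have hYm : ∀ k, Measurable (Y k) := fun k => (hY k).mono (hm _) le_rfl
  have hlY : ∀ k ω, |l * Y k ω| ≤ 1 := fun k ω => by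
    rw [abs_mul]; exact mul_le_one₀ hl (abs_nonneg _) (hY1 k ω)
  have hEb : ∀ k ω, |E k ω| ≤ Real.exp k := fun k ω => by
    rw [abs_of_pos (Real.exp_pos _), Real.exp_le_exp, Finset.mul_sum]
    refine (Finset.sum_le_sum fun i _ => (le_abs_self _).trans (hlY i ω)).trans ?_
    simp
  have hEi : ∀ k, Integrable (E k) μ := fun k =>
    Integrable.of_bound ((hEm k).mono (hm k) le_rfl).aestronglyMeasurable (Real.exp k)
      (Eventually.of_forall fun ω => hEb k ω)
  have hYi : ∀ k, Integrable (Y k) μ := fun k =>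
    Integrable.of_bound (hYm k).aestronglyMeasurable 1 (Eventually.of_forall fun ω => hY1 k ω)
  have hEY : ∀ k i, Integrable (fun ω => E k ω * Y i ω) μ := fun k i =>
    (hEi k).mul_bdd (c := 1) (hYm i).aestronglyMeasurable
      (Eventually.of_forall fun ω => hY1 i ω)
  have hsucc : ∀ k ω, E (k + 1) ω = E k ω * Real.exp (l * Y k ω) := fun k ω => by
    simp only [hE]
    rw [Finset.sum_range_succ, mul_add, Real.exp_add]
  have hEpos : ∀ k ω, 0 < E k ω := fun k ω => Real.exp_pos _
  have hcov : ∀ j k, j < k →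
      |∫ ω, (E (j + 1) ω - E j ω) * Y k ω ∂μ| ≤ φ (k - j) * (2 * |l| * ∫ ω, E j ω ∂μ) := by
    intro j k hjk
    have hZi : Integrable (fun ω => E (j + 1) ω - E j ω) μ := (hEi _).sub (hEi _)
    refine (abs_integral_mul_le_of_forall_setIntegral (hm (j + 1)) (hYi k)
      (((hEm (j + 1)).sub ((hEm j).mono (hmono j.le_succ) le_rfl)).stronglyMeasurable) hZi
      ?_ (hmix j k hjk)).trans ?_
    · exact hZi.mul_bdd (c := 1) (hYm k).aestronglyMeasurable
        (Eventually.of_forall fun ω => hY1 k ω)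
    · refine mul_le_mul_of_nonneg_left ?_ (hφ0 _)
      rw [← integral_const_mul]
      refine integral_mono hZi.abs ((hEi j).const_mul _) fun ω => ?_
      have h1 : E (j + 1) ω - E j ω = E j ω * (Real.exp (l * Y j ω) - 1) := by
        rw [hsucc]; ring
      have h2 := Real.abs_exp_sub_one_le (hlY j ω)
      have h3 : |l * Y j ω| ≤ |l| := by
        rw [abs_mul]; exact mul_le_of_le_one_right (abs_nonneg _) (hY1 j ω)
      change |E (j + 1) ω - E j ω| ≤ 2 * |l| * E j ω
      rw [h1, abs_mul, abs_of_pos (hEpos j ω)]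
      nlinarith [hEpos j ω]
  have hstep : ∀ k, ∫ ω, E (k + 1) ω ∂μ ≤ (1 + l ^ 2) * ∫ ω, E k ω ∂μ +
      2 * l ^ 2 * ∑ j ∈ Finset.range k, φ (k - j) * ∫ ω, E j ω ∂μ := by
    intro k
    have h1 : ∫ ω, E (k + 1) ω ∂μ ≤
        (1 + l ^ 2) * ∫ ω, E k ω ∂μ + l * ∫ ω, E k ω * Y k ω ∂μ := by
      rw [← integral_const_mul, ← integral_const_mul,
        ← integral_add ((hEi k).const_mul _) ((hEY k k).const_mul _)]
      refine integral_mono (hEi _) (((hEi k).const_mul _).add ((hEY k k).const_mul _))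
        fun ω => ?_
      have h2 := (abs_le.1 (Real.abs_exp_sub_one_sub_id_le (hlY k ω))).2
      have h3 : (l * Y k ω) ^ 2 ≤ l ^ 2 := by
        rw [mul_pow]
        exact mul_le_of_le_one_right (sq_nonneg l) ((sq_le_one_iff_abs_le_one _).2 (hY1 k ω))
      simp only [hsucc]
      nlinarith [hEpos k ω]
    have h4 : ∫ ω, E k ω * Y k ω ∂μ =
        ∑ j ∈ Finset.range k, ∫ ω, (E (j + 1) ω - E j ω) * Y k ω ∂μ := by
      have h5 : ∀ ω, E k ω * Y k ω =
          Y k ω + ∑ j ∈ Finset.range k, (E (j + 1) ω - E j ω) * Y k ω := fun ω => by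
        rw [← Finset.sum_mul, Finset.sum_range_sub (fun j => E j ω)]
        simp [hE]; ring
      have h6 : ∀ j ∈ Finset.range k,
          Integrable (fun ω => (E (j + 1) ω - E j ω) * Y k ω) μ := fun j _ => by
        simp only [sub_mul]
        exact (hEY _ _).sub (hEY _ _)
      simp_rw [h5]
      rw [integral_add (hYi k) (integrable_finsetSum _ h6), hY0, zero_add,
        integral_finsetSum _ h6]
    have h7 : l * ∫ ω, E k ω * Y k ω ∂μ ≤
        2 * l ^ 2 * ∑ j ∈ Finset.range k, φ (k - j) * ∫ ω, E j ω ∂μ := by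
      refine (le_abs_self _).trans ?_
      rw [abs_mul, h4]
      calc |l| * |∑ j ∈ Finset.range k, ∫ ω, (E (j + 1) ω - E j ω) * Y k ω ∂μ|
          ≤ |l| * ∑ j ∈ Finset.range k, φ (k - j) * (2 * |l| * ∫ ω, E j ω ∂μ) :=
            mul_le_mul_of_nonneg_left ((Finset.abs_sum_le_sum_abs _ _).trans
              (Finset.sum_le_sum fun j hj => hcov j k (Finset.mem_range.1 hj))) (abs_nonneg _)
        _ = 2 * l ^ 2 * ∑ j ∈ Finset.range k, φ (k - j) * ∫ ω, E j ω ∂μ := by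
            rw [← sq_abs l, Finset.mul_sum, Finset.mul_sum]
            exact Finset.sum_congr rfl fun j _ => by ring
    linarith
  have hlag : ∀ k, ∑ j ∈ Finset.range k, φ (k - j) ≤ ∑' n, φ (n + 1) := fun k => by
    rw [← Finset.sum_range_reflect]
    refine le_trans (Finset.sum_le_sum fun j hj => ?_)
      (hφ.sum_le_tsum (Finset.range k) fun i _ => hφ0 _)
    rw [show k - (k - 1 - j) = j + 1 by have := Finset.mem_range.1 hj; omega]
  change ∫ ω, E n ω ∂μ ≤ _
  induction n using Nat.strong_induction_on with
  | _ n ih =>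
    rcases n with _ | k
    · simp [hE]
    · have hb : ∀ j ≤ k, ∫ ω, E j ω ∂μ ≤ (1 + l ^ 2 * K) ^ k := fun j hj =>
        (ih j (by omega)).trans (pow_le_pow_right₀ (by linarith) hj)
      have hpow : 0 ≤ (1 + l ^ 2 * K) ^ k := by positivity
      have hsum : ∑ j ∈ Finset.range k, φ (k - j) * ∫ ω, E j ω ∂μ ≤
          (∑' n, φ (n + 1)) * (1 + l ^ 2 * K) ^ k := by
        refine le_trans (Finset.sum_le_sum fun j hj => mul_le_mul_of_nonneg_left
          (hb j (Finset.mem_range.1 hj).le) (hφ0 _)) ?_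
        rw [← Finset.sum_mul]
        exact mul_le_mul_of_nonneg_right (hlag k) hpow
      calc ∫ ω, E (k + 1) ω ∂μ
          ≤ (1 + l ^ 2) * (1 + l ^ 2 * K) ^ k +
            2 * l ^ 2 * ((∑' n, φ (n + 1)) * (1 + l ^ 2 * K) ^ k) :=
          (hstep k).trans (by gcongr; exact hb k le_rfl)
        _ = (1 + l ^ 2 * K) ^ (k + 1) := by rw [pow_succ, hK]; ring

/-- Two-sided Gaussian tail bound under the assumptions of `integral_exp_sum_le`. -/
lemma measureReal_abs_sum_ge_le {Ω : Type*} [m0 : MeasurableSpace Ω] {μ : Measure Ω}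
    [IsProbabilityMeasure μ] {m : ℕ → MeasurableSpace Ω} (hm : ∀ j, m j ≤ m0)
    (hmono : Monotone m) {Y : ℕ → Ω → ℝ} (hY : ∀ j, Measurable[m (j + 1)] (Y j))
    (hY1 : ∀ j ω, |Y j ω| ≤ 1) (hY0 : ∀ j, ∫ ω, Y j ω ∂μ = 0) {φ : ℕ → ℝ}
    (hφ0 : ∀ n, 0 ≤ φ n) (hφ : Summable fun n => φ (n + 1))
    (hmix : ∀ j k, j < k → ∀ A, MeasurableSet[m (j + 1)] A →
      |∫ ω in A, Y k ω ∂μ| ≤ φ (k - j) * μ.real A)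
    {K : ℝ} (hK : 1 + 2 * ∑' n, φ (n + 1) ≤ K) {n : ℕ} (hn : 0 < n) {a : ℝ} (ha : 0 ≤ a)
    (han : a ≤ n) :
    μ.real {ω | a ≤ |∑ i ∈ Finset.range n, Y i ω|} ≤
      2 * Real.exp (-(a ^ 2 / (4 * n * K))) := by
  have hK1 : 1 ≤ K := by
    have : 0 ≤ ∑' n, φ (n + 1) := tsum_nonneg fun n => hφ0 _
    linarith
  have hn' : (0 : ℝ) < n := by exact_mod_cast hn
  set l : ℝ := a / (2 * n * K) with hl
  have hl0 : 0 ≤ l := by positivity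
  have hl1 : l ≤ 1 := by
    rw [hl, div_le_one (by positivity)]
    nlinarith
  set S : Ω → ℝ := fun ω => ∑ i ∈ Finset.range n, Y i ω with hS
  have hSm : Measurable S :=
    Finset.measurable_fun_sum _ fun i _ => (hY i).mono (hm _) le_rfl
  have hSb : ∀ ω, |S ω| ≤ n := fun ω => by
    refine (Finset.abs_sum_le_sum_abs _ _).trans
      ((Finset.sum_le_sum fun i _ => hY1 i ω).trans ?_)
    simp
  have hint : ∀ t : ℝ, Integrable (fun ω => Real.exp (t * S ω)) μ := fun t => by
    refine Integrable.of_bound (Real.measurable_exp.comp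
      (hSm.const_mul t)).aestronglyMeasurable (Real.exp (|t| * n))
      (Eventually.of_forall fun ω => ?_)
    rw [Real.norm_eq_abs, abs_of_pos (Real.exp_pos _), Real.exp_le_exp]
    refine (le_abs_self _).trans ?_
    rw [abs_mul]
    exact mul_le_mul_of_nonneg_left (hSb ω) (abs_nonneg t)
  have hmgf : ∀ t : ℝ, |t| = l → ProbabilityTheory.mgf S μ t ≤ Real.exp (n * (l ^ 2 * K)) := by
    intro t ht
    have ht2 : t ^ 2 = l ^ 2 := by rw [← sq_abs, ht]
    refine (integral_exp_sum_le hm hmono hY hY1 hY0 hφ0 hφ hmix (ht.trans_le hl1) n).trans ?_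
    rw [ht2, Real.exp_nat_mul]
    refine pow_le_pow_left₀ ?_ ?_ n
    · have : 0 ≤ ∑' n, φ (n + 1) := tsum_nonneg fun n => hφ0 _
      positivity
    · refine le_trans ?_ (Real.add_one_le_exp _)
      nlinarith [mul_le_mul_of_nonneg_left hK (sq_nonneg l)]
  have hexp : -(l * a) + n * (l ^ 2 * K) = -(a ^ 2 / (4 * n * K)) := by
    rw [hl]; field_simp; ring
  have hup : μ.real {ω | a ≤ S ω} ≤ Real.exp (-(a ^ 2 / (4 * n * K))) := by
    refine (ProbabilityTheory.measure_ge_le_exp_mul_mgf a hl0 (hint l)).trans ?_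
    rw [← hexp, Real.exp_add, neg_mul]
    exact mul_le_mul_of_nonneg_left (hmgf l (abs_of_nonneg hl0)) (Real.exp_pos _).le
  have hlo : μ.real {ω | S ω ≤ -a} ≤ Real.exp (-(a ^ 2 / (4 * n * K))) := by
    refine (ProbabilityTheory.measure_le_le_exp_mul_mgf (-a) (neg_nonpos.2 hl0)
      (hint (-l))).trans ?_
    rw [← hexp, Real.exp_add, neg_neg, mul_neg]
    exact mul_le_mul_of_nonneg_left (hmgf (-l) (by rw [abs_neg, abs_of_nonneg hl0]))
      (Real.exp_pos _).le
  have hsub : {ω | a ≤ |∑ i ∈ Finset.range n, Y i ω|} ⊆ {ω | a ≤ S ω} ∪ {ω | S ω ≤ -a} := by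
    intro ω hω
    rcases le_abs.1 (show a ≤ |S ω| from hω) with h | h
    · exact Or.inl h
    · exact Or.inr (show S ω ≤ -a by linarith)
  have h1 := measureReal_mono (μ := μ) hsub
  have h2 := measureReal_union_le (μ := μ) {ω | a ≤ S ω} {ω | S ω ≤ -a}
  linarith

section Mixing

variable {Ω : Type*} {X : ℕ → Ω → ℝ}

lemma sigmaGen_mono {S T : Set ℕ} (h : S ⊆ T) : sigmaGen X S ≤ sigmaGen X T :=
  biSup_mono h

lemma measurable_sigmaGen {S : Set ℕ} {i : ℕ} (hi : i ∈ S) : Measurable[sigmaGen X S] (X i) :=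
  (comap_measurable (X i)).mono
    (le_iSup₂ (f := fun i (_ : i ∈ S) => MeasurableSpace.comap (X i) inferInstance) i hi) le_rfl

variable [MeasurableSpace Ω] {μ : Measure Ω}

lemma sigmaGen_le (hX : ∀ i, Measurable (X i)) (S : Set ℕ) :
    sigmaGen X S ≤ ‹MeasurableSpace Ω› :=
  iSup₂_le fun i _ => (hX i).comap_le

lemma phiCoef_nonneg (n : ℕ) : 0 ≤ phiCoef X μ n :=
  Real.sSup_nonneg (by rintro r ⟨k, -, A, B, -, -, -, rfl⟩; exact abs_nonneg _)

variable [IsProbabilityMeasure μ]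

lemma abs_condProb_sub_le_one (A B : Set Ω) :
    |(μ (A ∩ B)).toReal / (μ A).toReal - (μ B).toReal| ≤ 1 := by
  have h1 : (μ (A ∩ B)).toReal / (μ A).toReal ≤ 1 :=
    div_le_one_of_le₀ (measureReal_mono inter_subset_left) ENNReal.toReal_nonneg
  have h2 : 0 ≤ (μ (A ∩ B)).toReal / (μ A).toReal := by positivity
  have h3 : (μ B).toReal ≤ 1 := measureReal_le_one
  have h4 : 0 ≤ (μ B).toReal := ENNReal.toReal_nonneg
  exact abs_le.2 ⟨by linarith, by linarith⟩

lemma phiCoef_le_one (n : ℕ) : phiCoef X μ n ≤ 1 :=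
  Real.sSup_le (by rintro r ⟨k, -, A, B, -, -, -, rfl⟩; exact abs_condProb_sub_le_one A B)
    zero_le_one

lemma abs_measureReal_inter_sub_le {k n : ℕ} (hk : 1 ≤ k) {A B : Set Ω}
    (hA : MeasurableSet[sigmaGen X {i | 1 ≤ i ∧ i ≤ k}] A)
    (hB : MeasurableSet[sigmaGen X {i | k + n ≤ i}] B) :
    |μ.real (A ∩ B) - μ.real A * μ.real B| ≤ phiCoef X μ n * μ.real A := by
  rcases eq_or_ne (μ A) 0 with h0 | h0
  · have h1 : μ (A ∩ B) = 0 := measure_mono_null inter_subset_left h0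
    simp [Measure.real, h0, h1]
  · have hpos : 0 < μ.real A := ENNReal.toReal_pos h0 (measure_ne_top μ A)
    have h1 : |μ.real (A ∩ B) / μ.real A - μ.real B| ≤ phiCoef X μ n := by
      refine le_csSup ⟨1, ?_⟩ ⟨k, hk, A, B, hA, hB, pos_iff_ne_zero.2 h0, rfl⟩
      rintro r ⟨k, -, A, B, -, -, -, rfl⟩
      exact abs_condProb_sub_le_one A B
    calc |μ.real (A ∩ B) - μ.real A * μ.real B|
        = |μ.real (A ∩ B) / μ.real A - μ.real B| * μ.real A := by
          rw [← abs_of_pos hpos, ← abs_mul, abs_of_pos hpos]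
          congr 1
          field_simp
      _ ≤ phiCoef X μ n * μ.real A := mul_le_mul_of_nonneg_right h1 hpos.le

lemma phiCoef_le_sqrt (n : ℕ) : phiCoef X μ n ≤ Real.sqrt (phiCoef X μ n) :=
  Real.le_sqrt_of_sq_le (pow_le_of_le_one (phiCoef_nonneg n) (phiCoef_le_one n) two_ne_zero)

lemma summable_phiCoef (hsum : Summable fun n : ℕ => Real.sqrt (phiCoef X μ (n + 1))) :
    Summable fun n => phiCoef X μ (n + 1) :=
  hsum.of_nonneg_of_le (fun _ => phiCoef_nonneg _) fun _ => phiCoef_le_sqrt _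

lemma tsum_phiCoef_le (hsum : Summable fun n : ℕ => Real.sqrt (phiCoef X μ (n + 1))) :
    ∑' n, phiCoef X μ (n + 1) ≤ ∑' n, Real.sqrt (phiCoef X μ (n + 1)) :=
  (summable_phiCoef hsum).tsum_le_tsum (fun _ => phiCoef_le_sqrt _) hsum

/-- Gaussian tail bound for the deviation of the empirical distribution function at a point. -/
lemma measureReal_abs_empDF_sub_ge_le (hX : ∀ i, Measurable (X i))
    (hsum : Summable fun n : ℕ => Real.sqrt (phiCoef X μ (n + 1)))
    {F : ℝ → ℝ} (hF : ∀ i, 1 ≤ i → ∀ x, F x = (μ {ω | X i ω ≤ x}).toReal)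
    {n : ℕ} (hn : 0 < n) {t : ℝ} (ht0 : 0 ≤ t) (ht1 : t ≤ 1) (x : ℝ) :
    μ.real {ω | t ≤ |empDF X n ω x - F x|} ≤
      2 * Real.exp (-(n * t ^ 2 /
        (4 * (1 + 2 * ∑' n, Real.sqrt (phiCoef X μ (n + 1)))))) := by
  set K : ℝ := 1 + 2 * ∑' n, Real.sqrt (phiCoef X μ (n + 1)) with hK
  have hK0 : 0 < K := by
    have : 0 ≤ ∑' n, Real.sqrt (phiCoef X μ (n + 1)) := tsum_nonneg fun n => Real.sqrt_nonneg _
    positivity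
  have hn' : (0 : ℝ) < n := by exact_mod_cast hn
  set B : ℕ → Set Ω := fun j => {ω | X (j + 1) ω ≤ x} with hB
  set Y : ℕ → Ω → ℝ := fun j ω => (B j).indicator 1 ω - F x with hYdef
  have hFB : ∀ j, μ.real (B j) = F x := fun j => (hF (j + 1) (by omega) x).symm
  have hFx0 : 0 ≤ F x := hFB 0 ▸ measureReal_nonneg
  have hFx1 : F x ≤ 1 := hFB 0 ▸ measureReal_le_one
  have hBm' : ∀ (S : Set ℕ) (j : ℕ), j + 1 ∈ S → MeasurableSet[sigmaGen X S] (B j) :=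
    fun S j hj => measurable_sigmaGen hj measurableSet_Iic
  have hBm : ∀ j, MeasurableSet (B j) := fun j => hX (j + 1) measurableSet_Iic
  have hi : ∀ j, Integrable ((B j).indicator (1 : Ω → ℝ)) μ := fun j =>
    (integrable_const (1 : ℝ)).indicator (hBm j)
  have hset : ∀ j A, MeasurableSet A →
      ∫ ω in A, Y j ω ∂μ = μ.real (A ∩ B j) - μ.real A * μ.real (B j) := by
    intro j A hA
    simp only [hYdef]
    rw [integral_sub (hi j).integrableOn (integrable_const _).integrableOn,
      integral_indicator_one (hBm j), setIntegral_const, smul_eq_mul, hFB,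
      measureReal_restrict_apply (hBm j), inter_comm]
  have key := measureReal_abs_sum_ge_le (μ := μ) (Y := Y)
    (m := fun j => sigmaGen X {i | 1 ≤ i ∧ i ≤ j}) (φ := phiCoef X μ) (K := K)
    (fun j => sigmaGen_le hX _)
    (fun j k hjk => sigmaGen_mono fun i hi => ⟨hi.1, hi.2.trans hjk⟩)
    (fun j => by
      have hone : Measurable[sigmaGen X {i | 1 ≤ i ∧ i ≤ j + 1}] (1 : Ω → ℝ) :=
        @measurable_const _ _ _ (_) 1
      exact (hone.indicator (hBm' _ j ⟨by omega, le_rfl⟩)).sub_const _)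
    (fun j ω => by
      change |(B j).indicator (1 : Ω → ℝ) ω - F x| ≤ 1
      rw [Set.indicator_apply, Pi.one_apply]
      split_ifs <;> rw [abs_le] <;> constructor <;> linarith)
    (fun j => by
      have := hset j univ MeasurableSet.univ
      simpa using this)
    phiCoef_nonneg (summable_phiCoef hsum)
    (fun j k hjk A hA => by
      rw [hset k A (sigmaGen_le hX _ A hA)]
      exact abs_measureReal_inter_sub_le (by omega) hA
        (hBm' _ k (show j + 1 + (k - j) ≤ k + 1 by omega)))
    (by have := tsum_phiCoef_le hsum; linarith) hn (a := n * t) (by positivity)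
    (mul_le_of_le_one_right hn'.le ht1)
  have hsumY : ∀ ω, ∑ i ∈ Finset.range n, Y i ω = n * (empDF X n ω x - F x) := fun ω => by
    have h1 : ∑ i ∈ Finset.Icc 1 n, (if X i ω ≤ x then (1 : ℝ) else 0) =
        ∑ i ∈ Finset.range n, (B i).indicator 1 ω := by
      rw [Finset.range_eq_Ico]
      exact (Finset.sum_Ico_add' (fun i => if X i ω ≤ x then (1 : ℝ) else 0) 0 n 1).symm
    simp only [hYdef, empDF, h1, Finset.sum_sub_distrib, Finset.sum_const, Finset.card_range,
      nsmul_eq_mul]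
    field_simp
  have hexp : (n * t) ^ 2 / (4 * n * K) = n * t ^ 2 / (4 * K) := by field_simp
  rw [hexp] at key
  convert key using 4 with ω
  rw [hsumY, abs_mul, abs_of_pos hn', mul_le_mul_iff_right₀ hn']

end Mixing

lemma empDF_mono {Ω : Type*} (X : ℕ → Ω → ℝ) (n : ℕ) (ω : Ω) : Monotone (empDF X n ω) := by
  intro x y hxy
  refine mul_le_mul_of_nonneg_left (Finset.sum_le_sum fun i _ => ?_) (by positivity)
  split_ifs with h1 h2
  · exact le_rfl
  · exact absurd (h1.trans hxy) h2
  · exact zero_le_one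
  · exact le_rfl

lemma exists_mem_Icc_succ {u : ℕ → ℝ} {x : ℝ} {n : ℕ} (hn : 0 < n) (h0 : u 0 ≤ x)
    (hx : x ≤ u n) : ∃ j < n, u j ≤ x ∧ x ≤ u (j + 1) := by
  induction n with
  | zero => omega
  | succ k ih =>
    rcases le_total (u k) x with h | h
    · exact ⟨k, by omega, h, hx⟩
    · rcases Nat.eq_zero_or_pos k with rfl | hk
      · exact ⟨0, by omega, h0, hx⟩
      · obtain ⟨j, hj, hj'⟩ := ih hk h
        exact ⟨j, by omega, hj'⟩

/-- Uniform control of `G - F` on an interval from control on a grid of mesh at most `t`, for `G`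
monotone and `F` with increments at most `d` times the length. -/
lemma abs_sub_le_of_grid {G F : ℝ → ℝ} (hG : Monotone G) {c r d t : ℝ} (hr : 0 ≤ r)
    (hd : 0 ≤ d)
    (hF : ∀ x ∈ Icc (c - r) (c + r), ∀ y ∈ Icc (c - r) (c + r), x ≤ y → F y - F x ≤ d * (y - x))
    {n : ℕ} (hn : 0 < n) (ht : 2 * r / n ≤ t)
    (hgrid : ∀ j ≤ n, |G (c - r + j * (2 * r / n)) - F (c - r + j * (2 * r / n))| ≤ t)
    {x : ℝ} (hx : x ∈ Icc (c - r) (c + r)) : |G x - F x| ≤ (1 + d) * t := by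
  have hn' : (0 : ℝ) < n := by exact_mod_cast hn
  set h : ℝ := 2 * r / n with hh
  have hh0 : 0 ≤ h := by positivity
  have hnh : n * h = 2 * r := by rw [hh]; field_simp
  have hmem : ∀ j ≤ n, c - r + j * h ∈ Icc (c - r) (c + r) := fun j hj => by
    have h1 : (j : ℝ) * h ≤ n * h := mul_le_mul_of_nonneg_right (by exact_mod_cast hj) hh0
    have h2 : 0 ≤ (j : ℝ) * h := by positivity
    exact ⟨by linarith, by linarith⟩
  obtain ⟨j, hj, hj1, hj2⟩ := exists_mem_Icc_succ (u := fun j : ℕ => c - r + j * h) hn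
    (by simpa using hx.1) (by simp only [hnh]; linarith [hx.2])
  have g1 := abs_le.1 (hgrid j hj.le)
  have g2 := abs_le.1 (hgrid (j + 1) hj)
  have f1 := hF _ (hmem j hj.le) x hx hj1
  have f2 := hF x hx _ (hmem (j + 1) hj) hj2
  have m1 := hG hj1
  have m2 := hG hj2
  push_cast at g2 f2 m2 hj2
  have e1 : d * (x - (c - r + j * h)) ≤ d * t :=
    mul_le_mul_of_nonneg_left (by nlinarith) hd
  have e2 : d * (c - r + (j + 1) * h - x) ≤ d * t :=
    mul_le_mul_of_nonneg_left (by nlinarith) hd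
  exact abs_le.2 ⟨by nlinarith, by nlinarith⟩

lemma tendsto_log_rpow_div_rpow_mul_loglog (c : ℝ) :
    Tendsto (fun n : ℕ => c * Real.log n ^ ((3 : ℝ) / 2) /
      ((n : ℝ) ^ ((1 : ℝ) / 2) * Real.log (Real.log n) ^ ((1 : ℝ) / 2))) atTop (nhds 0) := by
  have h1 : Tendsto (fun x : ℝ => Real.log x ^ ((3 : ℝ) / 2) / x ^ ((1 : ℝ) / 2)) atTop (nhds 0) :=
    (isLittleO_log_rpow_rpow_atTop ((3 : ℝ) / 2) (by norm_num)).tendsto_div_nhds_zero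
  have h2 : Tendsto (fun x : ℝ => (Real.log (Real.log x) ^ ((1 : ℝ) / 2))⁻¹) atTop (nhds 0) :=
    tendsto_inv_atTop_zero.comp ((tendsto_rpow_atTop (by norm_num)).comp
      (Real.tendsto_log_atTop.comp Real.tendsto_log_atTop))
  have h3 := ((h1.mul h2).const_mul c).comp tendsto_natCast_atTop_atTop
  simp only [mul_zero] at h3
  refine h3.congr fun n => ?_
  simp only [Function.comp, div_eq_mul_inv, mul_inv]
  ring

/-- **Theorem 2.4.** Under the conditions of Theorem 2.3, with probability 1,
`sup_{x ∈ [ξ_p - τ_n, ξ_p + τ_n]} |F_n(x) - F(x)| ≤ (1 + d) ((16C₃ + θ) log n / (4n))^{1/2}`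
for all sufficiently large `n`. -/
theorem bahadur_thm_2_4 {Ω : Type*} [MeasurableSpace Ω] (μ : Measure Ω)
    [IsProbabilityMeasure μ]
    (X : ℕ → Ω → ℝ) (hX : ∀ i, Measurable (X i))
    (hanti : Antitone (phiCoef X μ))
    (hmix : Tendsto (phiCoef X μ) atTop (nhds 0))
    (hsum : Summable fun n : ℕ => Real.sqrt (phiCoef X μ (n + 1)))
    (F : ℝ → ℝ) (hF : ∀ i, 1 ≤ i → ∀ x, F x = (μ {ω | X i ω ≤ x}).toReal)
    (p : ℝ) (hp : 0 < p ∧ p < 1)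
    (Np : Set ℝ) (hNp : Np ∈ nhds (quantile F p))
    (f : ℝ → ℝ) (hfc : ContinuousOn f Np) (hfpos : ∀ x ∈ Np, 0 < f x)
    (hFf : ∀ x ∈ Np, HasDerivAt F (f x) x)
    (d : ℝ) (hd : IsLUB (f '' Np) d) (hd0 : 0 < d)
    (θ : ℝ) (hθ : 0 < θ)
    (C3 : ℝ) (hC3 : C3 = 4 * (1 + 4 * ∑' n : ℕ, Real.sqrt (phiCoef X μ (n + 1))))
    (τ : ℕ → ℝ)
    (hτ : ∀ n : ℕ, τ n = Real.sqrt (16 * C3 + θ) * Real.log n ^ ((3 : ℝ) / 2) /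
      ((n : ℝ) ^ ((1 : ℝ) / 2) * Real.log (Real.log n) ^ ((1 : ℝ) / 2))) :
    ∀ᵐ ω ∂μ, ∀ᶠ n : ℕ in atTop,
      sSup ((fun x => |empDF X n ω x - F x|) ''
          Set.Icc (quantile F p - τ n) (quantile F p + τ n)) ≤
        (1 + d) * ((16 * C3 + θ) * Real.log n / (4 * n)) ^ ((1 : ℝ) / 2) := by
  have hS0 : 0 ≤ ∑' n, Real.sqrt (phiCoef X μ (n + 1)) := tsum_nonneg fun n => Real.sqrt_nonneg _
  set K : ℝ := 1 + 2 * ∑' n, Real.sqrt (phiCoef X μ (n + 1)) with hK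
  have hK0 : 0 < K := by positivity
  set D : ℝ := 16 * C3 + θ with hD
  have hDK : 64 * K ≤ D := by rw [hD, hC3, hK]; linarith
  set q : ℝ := quantile F p
  set t : ℕ → ℝ := fun n => Real.sqrt (D * Real.log n / (4 * n)) with ht
  have ht0 : ∀ n, 0 ≤ t n := fun n => Real.sqrt_nonneg _
  have htsq : ∀ n : ℕ, t n ^ 2 = D * Real.log n / (4 * n) := fun n => by
    refine Real.sq_sqrt (div_nonneg (mul_nonneg (by linarith) (Real.log_natCast_nonneg n))
      (by positivity))
  have hτlim : Tendsto τ atTop (nhds 0) :=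
    (tendsto_log_rpow_div_rpow_mul_loglog (Real.sqrt D)).congr fun n => (hτ n).symm
  have htlim : Tendsto t atTop (nhds 0) := by
    have h1 : Tendsto (fun x : ℝ => Real.log x / x) atTop (nhds 0) :=
      Real.isLittleO_log_id_atTop.tendsto_div_nhds_zero
    have h2 := ((h1.comp tendsto_natCast_atTop_atTop).const_mul (D / 4)).sqrt
    simp only [mul_zero, Real.sqrt_zero] at h2
    refine h2.congr fun n => ?_
    simp only [ht, Function.comp]
    congr 1
    rw [div_mul_div_comm]
  obtain ⟨ε, hε, hball⟩ := Metric.mem_nhds_iff.1 hNp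
  have hFinc : ∀ x ∈ Metric.ball q ε, ∀ y ∈ Metric.ball q ε, x ≤ y →
      F y - F x ≤ d * (y - x) := by
    refine (convex_ball q ε).image_sub_le_mul_sub_of_deriv_le
      (fun x hx => (hFf x (hball hx)).continuousAt.continuousWithinAt)
      (fun x hx => (hFf x (hball (interior_subset hx))).differentiableAt.differentiableWithinAt)
      fun x hx => ?_
    rw [(hFf x (hball (interior_subset hx))).deriv]
    exact hd.1 (mem_image_of_mem f (hball (interior_subset hx)))
  set u : ℕ → ℕ → ℝ := fun n j => q - τ n + j * (2 * τ n / n) with hu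
  have hev : ∀ᶠ n : ℕ in atTop, 3 ≤ n ∧ t n ≤ 1 ∧ τ n < ε ∧ τ n ≤ 1 :=
    (eventually_ge_atTop 3).and ((htlim.eventually (eventually_le_nhds one_pos)).and
      ((hτlim.eventually (eventually_lt_nhds hε)).and
        (hτlim.eventually (eventually_le_nhds one_pos))))
  obtain ⟨N, hN⟩ := eventually_atTop.1 hev
  set bad : ℕ → Set Ω := fun n =>
    {ω | N ≤ n ∧ ∃ j ≤ n, t n ≤ |empDF X n ω (u n j) - F (u n j)|} with hbad
  have hbadμ : ∀ n, μ (bad n) ≤ ENNReal.ofReal (4 * (1 / (n : ℝ) ^ 3)) := by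
    intro n
    by_cases hNn : N ≤ n
    · obtain ⟨hn3, htn, -, -⟩ := hN n hNn
      have hn' : (3 : ℝ) ≤ n := by exact_mod_cast hn3
      have hpt : ∀ j, μ.real {ω | t n ≤ |empDF X n ω (u n j) - F (u n j)|} ≤
          2 * (1 / (n : ℝ) ^ 4) := fun j => by
        refine (measureReal_abs_empDF_sub_ge_le hX hsum hF (by omega) (ht0 n) htn _).trans ?_
        rw [← hK, htsq]
        refine mul_le_mul_of_nonneg_left ?_ zero_le_two
        have hlog : 0 ≤ Real.log n := Real.log_natCast_nonneg n
        have h1 : 4 * Real.log n ≤ n * (D * Real.log n / (4 * n)) / (4 * K) := by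
          rw [show n * (D * Real.log n / (4 * n)) / (4 * K) = D * Real.log n / (16 * K) by
            field_simp; ring, le_div_iff₀ (by positivity)]
          nlinarith [mul_le_mul_of_nonneg_right hDK hlog]
        calc Real.exp (-(n * (D * Real.log n / (4 * n)) / (4 * K)))
            ≤ Real.exp (-(4 * Real.log n)) := Real.exp_le_exp.2 (neg_le_neg h1)
          _ = 1 / (n : ℝ) ^ 4 := by
            rw [Real.exp_neg, show 4 * Real.log n = ((4 : ℕ) : ℝ) * Real.log n by norm_num,
              Real.exp_nat_mul, Real.exp_log (by linarith), one_div]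
      have hsub : bad n ⊆ ⋃ j ∈ Finset.range (n + 1),
          {ω | t n ≤ |empDF X n ω (u n j) - F (u n j)|} := by
        rintro ω ⟨-, j, hj, hω⟩
        exact mem_biUnion (Finset.mem_coe.2 (Finset.mem_range.2 (Nat.lt_succ_of_le hj))) hω
      have hreal : μ.real (bad n) ≤ 4 * (1 / (n : ℝ) ^ 3) := by
        calc μ.real (bad n) ≤ _ := measureReal_mono hsub (measure_ne_top μ _)
          _ ≤ _ := measureReal_biUnion_finset_le _ _
          _ ≤ ∑ j ∈ Finset.range (n + 1), 2 * (1 / (n : ℝ) ^ 4) :=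
            Finset.sum_le_sum fun j _ => hpt j
          _ = (n + 1) * (2 * (1 / (n : ℝ) ^ 4)) := by simp
          _ ≤ (2 * n) * (2 * (1 / (n : ℝ) ^ 4)) := by
            gcongr; linarith
          _ = 4 * (1 / (n : ℝ) ^ 3) := by field_simp; norm_num
      rw [← ofReal_measureReal (measure_ne_top μ _)]
      exact ENNReal.ofReal_le_ofReal hreal
    · have : bad n = ∅ := by
        ext ω; simp [hbad, hNn]
      simp [this]
  have hBC : ∀ᵐ ω ∂μ, ∀ᶠ n in atTop, ω ∉ bad n := by
    refine ae_eventually_notMem (ne_top_of_le_ne_top ?_ (ENNReal.tsum_le_tsum hbadμ))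
    exact ((Real.summable_one_div_nat_pow.2 (by norm_num)).mul_left 4).tsum_ofReal_ne_top
  filter_upwards [hBC] with ω hω
  filter_upwards [hω, eventually_ge_atTop N] with n hnb hNn
  obtain ⟨hn3, -, hτε, hτ1⟩ := hN n hNn
  have hn' : (3 : ℝ) ≤ n := by exact_mod_cast hn3
  rw [← Real.sqrt_eq_rpow]
  change _ ≤ (1 + d) * t n
  refine Real.sSup_le ?_ (mul_nonneg (by linarith) (ht0 n))
  rintro _ ⟨x, hx, rfl⟩
  have hτ0 : 0 ≤ τ n := by linarith [hx.1, hx.2]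
  have hIcc : Icc (q - τ n) (q + τ n) ⊆ Metric.ball q ε := by
    rw [← Real.closedBall_eq_Icc]
    exact Metric.closedBall_subset_ball hτε
  refine abs_sub_le_of_grid (empDF_mono X n ω) hτ0 hd0.le
    (fun x hx y hy => hFinc x (hIcc hx) y (hIcc hy)) (n := n) (by omega) ?_ (fun j hj => ?_) hx
  · refine Real.le_sqrt_of_sq_le ?_
    have hlog : 1 ≤ Real.log n := by
      rw [Real.le_log_iff_exp_le (by linarith)]
      linarith [Real.exp_one_lt_d9]
    have hD64 : 64 ≤ D := by linarith
    rw [div_pow, div_le_div_iff₀ (by positivity) (by positivity)]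
    have h1 : (2 * τ n) ^ 2 ≤ 4 := by nlinarith
    have h2 : 64 ≤ D * Real.log n := by nlinarith
    nlinarith [mul_le_mul_of_nonneg_right h1 (by positivity : (0 : ℝ) ≤ 4 * n),
      mul_le_mul_of_nonneg_right h2 (by positivity : (0 : ℝ) ≤ (n : ℝ) ^ 2)]
  · exact (not_le.1 fun h => hnb ⟨hNn, j, hj, h⟩).le
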